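/- arXiv:2103.07648 — 2 statements merged into one kernel-verified Lean document; each statement's English description precedes it below -/
import Mathlib

section
/- For the Lie algebra 𝔤₄,₁₀, the fundamental tensors satisfy: F₁(e₁,e₁,e₃) = F₁(e₂,e₁,e₄) = −½, F₁(e₃,e₁,e₄) = −1; F₂(e₁,e₁,e₂) = ½, F₂(e₂,e₁,e₁) = 1, F₂(e₂,e₁,e₄) = −1, F₂(e₃,e₁,e₄) = ½, F₂(e₃,e₂,e₂) = 2; F₃(e₁,e₂,e₂) = 1, F₃(e₂,e₁,e₂) = ½, F₃(e₂,e₁,e₃) = −1, F₃(e₃,e₁,e₂) = −1, F₃(e₃,e₁,e₃) = ½; and the Lee forms satisfy θ₁(e₂) = θ₂(e₂) = θ₂(e₃) = 1, θ₃(e₄) = −2, with all other values θ_α(eᵢ) equal to zero. -/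
noncomputable section

/-- The underlying 4-dimensional real vector space. -/
abbrev V : Type := Fin 4 → ℝ

/-- The standard basis e₁,e₂,e₃,e₄ (indexed by 0,1,2,3). -/
def e (i : Fin 4) : V := Pi.single i 1

/-- The neutral metric g with g(e₁,e₁)=g(e₂,e₂)=1, g(e₃,e₃)=g(e₄,e₄)=−1. -/
def gm (x y : V) : ℝ := x 0 * y 0 + x 1 * y 1 - x 2 * y 2 - x 3 * y 3

/-- The signs ε₁=ε₂=1, ε₃=ε₄=−1. -/
def eps : Fin 4 → ℝ := ![1, 1, -1, -1]

/-- J₁ : e₁↦e₂, e₂↦−e₁, e₃↦−e₄, e₄↦e₃. -/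
def J1 (x : V) : V := ![-x 1, x 0, x 3, -x 2]

/-- J₂ : e₁↦e₃, e₂↦e₄, e₃↦−e₁, e₄↦−e₂. -/
def J2 (x : V) : V := ![-x 2, -x 3, x 0, x 1]

/-- J₃ : e₁↦−e₄, e₂↦e₃, e₃↦−e₂, e₄↦e₁. -/
def J3 (x : V) : V := ![x 3, -x 2, x 1, -x 0]

/-- Lie bracket of 𝔤₄,₁₀ : [e₂,e₃]=e₁, [e₂,e₄]=−e₃, [e₃,e₄]=e₂. -/
def br (x y : V) : V :=
  ![x 1 * y 2 - x 2 * y 1, x 2 * y 3 - x 3 * y 2, -(x 1 * y 3 - x 3 * y 1), 0]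

/-- Fundamental tensor F(x,y,z) = g((∇ₓ J)y, z) for an almost complex structure Jm. -/
def Fa (nab : V →ₗ[ℝ] V →ₗ[ℝ] V) (Jm : V → V) (x y z : V) : ℝ :=
  gm (nab x (Jm y) - Jm (nab x y)) z

/-- Lee form θ(z) = Σᵢ εᵢ F(eᵢ,eᵢ,z). -/
def theta (nab : V →ₗ[ℝ] V →ₗ[ℝ] V) (Jm : V → V) : V → ℝ :=
  fun z => ∑ i, eps i * Fa nab Jm (e i) (e i) z

/-- Curvature operator R(x,y)z = ∇ₓ∇_y z − ∇_y∇ₓ z − ∇_{[x,y]} z. -/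
def Rm (nab : V →ₗ[ℝ] V →ₗ[ℝ] V) (x y z : V) : V :=
  nab x (nab y z) - nab y (nab x z) - nab (br x y) z

/-- Curvature (0,4)-tensor R(x,y,z,w) = g(R(x,y)z, w). -/
def R4 (nab : V →ₗ[ℝ] V →ₗ[ℝ] V) (x y z w : V) : ℝ := gm (Rm nab x y z) w

/-- Ricci tensor ρ(y,z) = Σᵢ εᵢ R(eᵢ,y,z,eᵢ). -/
def ricci (nab : V →ₗ[ℝ] V →ₗ[ℝ] V) (y z : V) : ℝ :=
  ∑ i, eps i * R4 nab (e i) y z (e i)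

/-- Scalar curvature τ = Σⱼ εⱼ ρ(eⱼ,eⱼ). -/
def tau (nab : V →ₗ[ℝ] V →ₗ[ℝ] V) : ℝ := ∑ j, eps j * ricci nab (e j) (e j)

/-- Associated Ricci tensor ρ*(y,z) = Σᵢ εᵢ R(eᵢ,y,z,J eᵢ). -/
def ricciS (nab : V →ₗ[ℝ] V →ₗ[ℝ] V) (Jm : V → V) (y z : V) : ℝ :=
  ∑ i, eps i * R4 nab (e i) y z (Jm (e i))

/-- ∗-scalar curvature τ* = Σⱼ εⱼ ρ*(eⱼ,eⱼ). -/
def tauS (nab : V →ₗ[ℝ] V →ₗ[ℝ] V) (Jm : V → V) : ℝ :=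
  ∑ j, eps j * ricciS nab Jm (e j) (e j)

/-- ∗∗-scalar curvature τ** = Σⱼ εⱼ ρ*(eⱼ,J eⱼ). -/
def tauSS (nab : V →ₗ[ℝ] V →ₗ[ℝ] V) (Jm : V → V) : ℝ :=
  ∑ j, eps j * ricciS nab Jm (e j) (Jm (e j))

/-- Basic sectional curvature k_{ij} = R(eᵢ,eⱼ,eⱼ,eᵢ)/(εᵢεⱼ). -/
def sek (nab : V →ₗ[ℝ] V →ₗ[ℝ] V) (i j : Fin 4) : ℝ :=
  R4 nab (e i) (e j) (e j) (e i) / (eps i * eps j)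

/-- Antisymmetrized Kronecker symbol used to encode curvature-type tensors. -/
def D (a b i j : Fin 4) : ℝ :=
  (if i = a ∧ j = b then (1 : ℝ) else 0) - (if i = b ∧ j = a then (1 : ℝ) else 0)

/-- Coordinate formula for the connection determined by the Koszul identity on 𝔤₄,₁₀. -/
lemma koszul_explicit (nab : V →ₗ[ℝ] V →ₗ[ℝ] V)
    (hK : ∀ x y z : V, 2 * gm (nab x y) z = gm (br x y) z + gm (br z x) y + gm (br z y) x)
    (x y : V) :
    nab x y = ![(x 1 * y 2 - x 2 * y 1) / 2, x 2 * y 3 + (x 2 * y 0 + x 0 * y 2) / 2,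
      -(x 1 * y 3) + (x 1 * y 0 + x 0 * y 1) / 2, x 2 * y 1 + x 1 * y 2] := by
  ext k
  have h := hK x y (e k)
  fin_cases k <;> simp [gm, br, e] at h ⊢ <;> linarith

theorem stmt_16
    (nab : V →ₗ[ℝ] V →ₗ[ℝ] V)
    (hK : ∀ x y z : V, 2 * gm (nab x y) z = gm (br x y) z + gm (br z x) y + gm (br z y) x) :
    Fa nab J1 (e 0) (e 0) (e 2) = -(1/2) ∧
    Fa nab J1 (e 1) (e 0) (e 3) = -(1/2) ∧
    Fa nab J1 (e 2) (e 0) (e 3) = -1 ∧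
    Fa nab J2 (e 0) (e 0) (e 1) = 1/2 ∧
    Fa nab J2 (e 1) (e 0) (e 0) = 1 ∧
    Fa nab J2 (e 1) (e 0) (e 3) = -1 ∧
    Fa nab J2 (e 2) (e 0) (e 3) = 1/2 ∧
    Fa nab J2 (e 2) (e 1) (e 1) = 2 ∧
    Fa nab J3 (e 0) (e 1) (e 1) = 1 ∧
    Fa nab J3 (e 1) (e 0) (e 1) = 1/2 ∧
    Fa nab J3 (e 1) (e 0) (e 2) = -1 ∧
    Fa nab J3 (e 2) (e 0) (e 1) = -1 ∧
    Fa nab J3 (e 2) (e 0) (e 2) = 1/2 ∧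
    theta nab J1 (e 1) = 1 ∧ theta nab J2 (e 1) = 1 ∧
    theta nab J2 (e 2) = 1 ∧ theta nab J3 (e 3) = -2 ∧
    theta nab J1 (e 0) = 0 ∧ theta nab J1 (e 2) = 0 ∧ theta nab J1 (e 3) = 0 ∧
    theta nab J2 (e 0) = 0 ∧ theta nab J2 (e 3) = 0 ∧
    theta nab J3 (e 0) = 0 ∧ theta nab J3 (e 1) = 0 ∧ theta nab J3 (e 2) = 0
  := by
    have hn := koszul_explicit nab hK
    simp only [theta, Fa, hn, Fin.sum_univ_four]
    simp [gm, eps, J1, J2, J3, e]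
    norm_num
end
end

section
/- For the Lie algebra 𝔤₄,₁₀: the curvature tensor satisfies R₁₂₁₂ = ¼, R₁₂₂₄ = ½, R₁₃₁₃ = −¼, R₁₃₃₄ = ½, R₂₃₂₃ = 7/4, R₂₄₂₄ = −1, R₃₄₃₄ = 1, all other components vanishing except those determined from these via the symmetries R(x,y,z,w) = −R(y,x,z,w) = −R(x,y,w,z) = R(z,w,x,y); the Ricci tensor has diagonal values ρ(e₁,e₁) = −½, ρ(e₂,e₂) = ½, ρ(e₃,e₃) = −½, ρ(e₄,e₄) = 2; the scalar curvature τ is negative; the ∗-scalar curvatures vanish, τ₁* = τ₂* = τ₃* = 0; and the basic sectional curvatures are k₁₂ = k₁₃ = −¼, k₁₄ = 0, k₂₃ = 7/4, k₂₄ = k₃₄ = −1. -/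
noncomputable section

/-- The expected curvature tensor of 𝔤₄,₁₀ : nonzero components generated by
R₁₂₁₂=¼, R₁₂₂₄=½, R₁₃₁₃=−¼, R₁₃₃₄=½, R₂₃₂₃=7/4, R₂₄₂₄=−1, R₃₄₃₄=1 and the
symmetries R(x,y,z,w) = −R(y,x,z,w) = −R(x,y,w,z) = R(z,w,x,y). -/
def T (i j k l : Fin 4) : ℝ :=
  (1/4) * D 0 1 i j * D 0 1 k l
  + (1/2) * (D 0 1 i j * D 1 3 k l + D 1 3 i j * D 0 1 k l)
  - (1/4) * D 0 2 i j * D 0 2 k l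
  + (1/2) * (D 0 2 i j * D 2 3 k l + D 2 3 i j * D 0 2 k l)
  + (7/4) * D 1 2 i j * D 1 2 k l
  - D 1 3 i j * D 1 3 k l
  + D 2 3 i j * D 2 3 k l

/-- The Levi-Civita connection of `gm` on `𝔤₄,₁₀` in coordinates, read off from the Koszul formula. -/
theorem koszul_apply (nab : V →ₗ[ℝ] V →ₗ[ℝ] V)
    (hK : ∀ x y z : V, 2 * gm (nab x y) z = gm (br x y) z + gm (br z x) y + gm (br z y) x)
    (x y : V) :
    nab x y = ![(x 1 * y 2 - x 2 * y 1) / 2, (2 * x 2 * y 3 + x 2 * y 0 + x 0 * y 2) / 2,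
      (x 1 * y 0 + x 0 * y 1 - 2 * x 1 * y 3) / 2, x 1 * y 2 + x 2 * y 1] := by
  ext i
  have h := hK x y (e i)
  fin_cases i <;> simp [gm, br, e] at h ⊢ <;> linarith

/-- The coordinate `x ∧ y` on the plane spanned by `e a` and `e b`. -/
def plucker (a b : Fin 4) (x y : V) : ℝ := x a * y b - x b * y a

theorem plucker_e (a b i j : Fin 4) : plucker a b (e i) (e j) = D a b i j := by
  simp only [plucker, D, e, Pi.single_apply, ite_and, eq_comm (a := a), eq_comm (a := b)]
  split_ifs <;> simp

/-- The curvature tensor of `𝔤₄,₁₀` as a quadratic form in Plücker coordinates. -/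
theorem R4_eq (nab : V →ₗ[ℝ] V →ₗ[ℝ] V)
    (hK : ∀ x y z : V, 2 * gm (nab x y) z = gm (br x y) z + gm (br z x) y + gm (br z y) x)
    (x y z w : V) :
    R4 nab x y z w =
      (1/4) * plucker 0 1 x y * plucker 0 1 z w
      + (1/2) * (plucker 0 1 x y * plucker 1 3 z w + plucker 1 3 x y * plucker 0 1 z w)
      - (1/4) * plucker 0 2 x y * plucker 0 2 z w
      + (1/2) * (plucker 0 2 x y * plucker 2 3 z w + plucker 2 3 x y * plucker 0 2 z w)
      + (7/4) * plucker 1 2 x y * plucker 1 2 z w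
      - plucker 1 3 x y * plucker 1 3 z w
      + plucker 2 3 x y * plucker 2 3 z w := by
  simp [R4, Rm, koszul_apply nab hK, gm, br, plucker]
  ring

theorem stmt_17
    (nab : V →ₗ[ℝ] V →ₗ[ℝ] V)
    (hK : ∀ x y z : V, 2 * gm (nab x y) z = gm (br x y) z + gm (br z x) y + gm (br z y) x) :
    R4 nab (e 0) (e 1) (e 0) (e 1) = 1/4 ∧
    R4 nab (e 0) (e 1) (e 1) (e 3) = 1/2 ∧
    R4 nab (e 0) (e 2) (e 0) (e 2) = -(1/4) ∧
    R4 nab (e 0) (e 2) (e 2) (e 3) = 1/2 ∧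
    R4 nab (e 1) (e 2) (e 1) (e 2) = 7/4 ∧
    R4 nab (e 1) (e 3) (e 1) (e 3) = -1 ∧
    R4 nab (e 2) (e 3) (e 2) (e 3) = 1 ∧
    (∀ i j k l : Fin 4, R4 nab (e i) (e j) (e k) (e l) = T i j k l) ∧
    ricci nab (e 0) (e 0) = -(1/2) ∧ ricci nab (e 1) (e 1) = 1/2 ∧
    ricci nab (e 2) (e 2) = -(1/2) ∧ ricci nab (e 3) (e 3) = 2 ∧
    tau nab < 0 ∧
    tauS nab J1 = 0 ∧ tauS nab J2 = 0 ∧ tauS nab J3 = 0 ∧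
    sek nab 0 1 = -(1/4) ∧ sek nab 0 2 = -(1/4) ∧ sek nab 0 3 = 0 ∧
    sek nab 1 2 = 7/4 ∧ sek nab 1 3 = -1 ∧ sek nab 2 3 = -1
  := by
    refine ⟨?_, ?_, ?_, ?_, ?_, ?_, ?_, fun i j k l => ?_, ?_⟩
    case refine_8 => simp only [R4_eq nab hK, plucker_e, T]
    case refine_9 =>
      refine ⟨?_, ?_, ?_, ?_, ?_, ?_, ?_, ?_, ?_, ?_, ?_, ?_, ?_, ?_⟩ <;>
        simp [tau, tauS, ricci, ricciS, sek, R4_eq nab hK, Fin.sum_univ_four, plucker, e, eps,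
          J1, J2, J3] <;> norm_num
    all_goals simp [R4_eq nab hK, plucker, e]
end
end
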